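/- arXiv:1908.03786 — 2 statements merged into one kernel-verified Lean document; each statement's English description precedes it below -/
import Mathlib

section
/- Let $k > 0$ and let $\ell \colon \mathbb{R} \times \mathbb{R} \to \mathbb{C}$ be continuously differentiable and $2\pi$-periodic in each of its two variables. Then there exists a constant $C > 0$ (depending only on $k$ and $\ell$) such that for every $R \ge 1$, every $\delta \in (0, \pi/2)$ with $2\sin\delta \ge \delta$, and every continuously differentiable $2\pi$-periodic function $\varphi \colon \mathbb{R} \to \mathbb{C}$, $\left( \int_0^{2\pi} \left| \int_0^{2\pi} e^{2 i k R \cos(\theta - s)}\, \ell(\theta, s)\, \varphi(s)\, ds \right|^2 d\theta \right)^{1/2} \le C \left[ \delta \left( \int_0^{2\pi} |\varphi(s)|^2 ds \right)^{1/2} + \frac{1}{R\delta} \left( \int_0^{2\pi} \left( |\varphi(s)|^2 + |\varphi'(s)|^2 \right) ds \right)^{1/2} \right]$. -/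
open MeasureTheory intervalIntegral Real

/-- Weighted Cauchy–Schwarz inequality. -/
theorem sq_integral_mul_le {a b : ℝ} (hab : a ≤ b) {w h : ℝ → ℝ} (hw : Continuous w)
    (hh : Continuous h) (hw0 : ∀ x, 0 ≤ w x) (hpos : 0 < ∫ x in a..b, w x) :
    (∫ x in a..b, w x * h x) ^ 2 ≤ (∫ x in a..b, w x) * ∫ x in a..b, w x * h x ^ 2 := by
  set A := ∫ x in a..b, w x with hA
  set B := ∫ x in a..b, w x * h x with hB
  have h0 : 0 ≤ ∫ x in a..b, w x * (A * h x - B) ^ 2 :=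
    integral_nonneg hab fun x _ => mul_nonneg (hw0 x) (sq_nonneg _)
  have h1 : (∫ x in a..b, w x * (A * h x - B) ^ 2) =
      A ^ 2 * (∫ x in a..b, w x * h x ^ 2) - 2 * A * B * B + B ^ 2 * A := by
    have : ∀ x, w x * (A * h x - B) ^ 2 =
      A ^ 2 * (w x * h x ^ 2) - 2 * A * B * (w x * h x) + B ^ 2 * w x := fun x => by ring
    simp_rw [this]
    rw [intervalIntegral.integral_add, intervalIntegral.integral_sub,
      intervalIntegral.integral_const_mul, intervalIntegral.integral_const_mul,
      intervalIntegral.integral_const_mul] <;>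
    exact Continuous.intervalIntegrable (by fun_prop) _ _
  rw [h1] at h0
  have h2 : 0 ≤ A * (A * (∫ x in a..b, w x * h x ^ 2) - B ^ 2) := by linarith
  have h3 := nonneg_of_mul_nonneg_right h2 hpos
  linarith

theorem integral_inv_sq_add_sin_sq_le {δ : ℝ} (hδ : 0 < δ) :
    ∫ u in (0:ℝ)..(2 * π), (δ ^ 2 + Real.sin u ^ 2)⁻¹ ≤ π ^ 2 / δ := by
  have hpi := Real.pi_pos
  have hc : Continuous fun u : ℝ => (δ ^ 2 + Real.sin u ^ 2)⁻¹ :=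
    Continuous.inv₀ (by fun_prop) fun u => by positivity
  have hper : Function.Periodic (fun u : ℝ => (δ ^ 2 + Real.sin u ^ 2)⁻¹) π := fun u => by
    simp [Real.sin_add_pi]
  have hd : ∀ u, HasDerivAt (fun u : ℝ => π / (2 * δ) * Real.arctan (2 / (π * δ) * u))
      (δ ^ 2 + (2 / π * u) ^ 2)⁻¹ u := fun u => by
    have := (((hasDerivAt_id u).const_mul (2 / (π * δ))).arctan).const_mul (π / (2 * δ))
    refine this.congr_deriv ?_
    simp only [id]
    field_simp
  have hc2 : Continuous fun u : ℝ => (δ ^ 2 + (2 / π * u) ^ 2)⁻¹ :=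
    Continuous.inv₀ (by fun_prop) fun u => by positivity
  have h1 : ∫ u in (-(π / 2))..(π / 2), (δ ^ 2 + Real.sin u ^ 2)⁻¹ ≤ π ^ 2 / (2 * δ) := by
    calc _ ≤ ∫ u in (-(π / 2))..(π / 2), (δ ^ 2 + (2 / π * u) ^ 2)⁻¹ := by
          refine integral_mono_on (by linarith) (hc.intervalIntegrable _ _)
            (hc2.intervalIntegrable _ _) fun u hu => ?_
          have h := Real.mul_abs_le_abs_sin (abs_le.2 ⟨hu.1, hu.2⟩)
          have h' : (2 / π * u) ^ 2 ≤ Real.sin u ^ 2 := by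
            rw [sq_le_sq, abs_mul, abs_of_pos (by positivity : 0 < 2 / π)]
            exact h
          gcongr
      _ = _ := integral_eq_sub_of_hasDerivAt (fun u _ => hd u) (hc2.intervalIntegrable _ _)
      _ ≤ π / (2 * δ) * (π / 2) - π / (2 * δ) * (-(π / 2)) := by
          gcongr
          · exact (Real.arctan_lt_pi_div_two _).le
          · exact (Real.neg_pi_div_two_lt_arctan _).le
      _ = _ := by ring
  have h2 : ∫ u in (0:ℝ)..π, (δ ^ 2 + Real.sin u ^ 2)⁻¹ =
      ∫ u in (-(π / 2))..(π / 2), (δ ^ 2 + Real.sin u ^ 2)⁻¹ := by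
    have := hper.intervalIntegral_add_eq 0 (-(π / 2))
    convert this using 2 <;> ring
  have h3 : ∫ u in π..(2 * π), (δ ^ 2 + Real.sin u ^ 2)⁻¹ =
      ∫ u in (-(π / 2))..(π / 2), (δ ^ 2 + Real.sin u ^ 2)⁻¹ := by
    have := hper.intervalIntegral_add_eq π (-(π / 2))
    convert this using 2 <;> ring
  rw [← integral_add_adjacent_intervals (hc.intervalIntegrable 0 π)
    (hc.intervalIntegrable π (2 * π)), h2, h3]
  calc _ ≤ _ := add_le_add h1 h1
    _ = _ := by field_simp; ring

/-- Van der Corput type bound for the phase `cos (θ - s)`, with the neighbourhood of the stationary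
points cut off smoothly by the weight `(δ ^ 2 + sin (θ - s) ^ 2)⁻¹`. -/
theorem norm_integral_exp_cos_mul_le {lam δ : ℝ} (hlam : 0 < lam) (hδ : 0 < δ) (θ : ℝ)
    {g g' : ℝ → ℂ} (hg : ∀ s, HasDerivAt g (g' s) s) (hg' : Continuous g')
    (hper : Function.Periodic g (2 * π)) :
    ‖∫ s in (0:ℝ)..(2 * π), Complex.exp (Complex.I * lam * Real.cos (θ - s)) * g s‖ ≤
      (δ ^ 2 + 1 / lam) * (∫ s in (0:ℝ)..(2 * π), (δ ^ 2 + Real.sin (θ - s) ^ 2)⁻¹ * ‖g s‖) +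
        1 / (2 * δ * lam) * ∫ s in (0:ℝ)..(2 * π), ‖g' s‖ := by
  have hgc : Continuous g := continuous_iff_continuousAt.2 fun s => (hg s).continuousAt
  have hD : ∀ s, 0 < δ ^ 2 + Real.sin (θ - s) ^ 2 := fun s => by positivity
  set D : ℝ → ℝ := fun s => δ ^ 2 + Real.sin (θ - s) ^ 2 with hDdef
  have hDc : Continuous D := by fun_prop
  have hDi : Continuous fun s => (D s)⁻¹ := hDc.inv₀ fun s => (hD s).ne'
  set E : ℝ → ℂ := fun s => Complex.exp (Complex.I * lam * Real.cos (θ - s)) with hE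
  have hEc : Continuous E := by fun_prop
  have hEn : ∀ s, ‖E s‖ = 1 := fun s => by
    have : Complex.I * lam * Real.cos (θ - s) = ((lam * Real.cos (θ - s) : ℝ) : ℂ) * Complex.I := by
      push_cast; ring
    simp only [hE, this, Complex.norm_exp_ofReal_mul_I]
  have hsin : ∀ s, HasDerivAt (fun s => Real.sin (θ - s)) (-Real.cos (θ - s)) s := fun s => by
    simpa using (((hasDerivAt_id s).const_sub θ).sin)
  have hcos : ∀ s, HasDerivAt (fun s => Real.cos (θ - s)) (Real.sin (θ - s)) s := fun s => by
    simpa using (((hasDerivAt_id s).const_sub θ).cos)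
  have hEd : ∀ s, HasDerivAt E (E s * (Complex.I * lam * Real.sin (θ - s))) s := fun s =>
    ((hcos s).ofReal_comp.const_mul (Complex.I * lam)).cexp
  set v : ℝ → ℝ := fun s => Real.sin (θ - s) / D s with hv
  set v' : ℝ → ℝ := fun s =>
    -Real.cos (θ - s) * (δ ^ 2 - Real.sin (θ - s) ^ 2) / D s ^ 2 with hv'
  have hvd : ∀ s, HasDerivAt v (v' s) s := fun s => by
    have h := (hsin s).div (((hsin s).pow 2).const_add (δ ^ 2)) (hD s).ne'
    refine h.congr_deriv ?_
    simp only [hv', hDdef, Pi.pow_apply]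
    push_cast
    ring
  have hvc : Continuous v := continuous_iff_continuousAt.2 fun s => (hvd s).continuousAt
  have hv'c : Continuous v' :=
    Continuous.div (by fun_prop) (by fun_prop) fun s => (pow_pos (hD s) 2).ne'
  have hvb : ∀ s, |v s| ≤ 1 / (2 * δ) := fun s => by
    simp only [hv]
    rw [abs_div, abs_of_pos (hD s), div_le_div_iff₀ (hD s) (by positivity)]
    change _ ≤ 1 * (δ ^ 2 + Real.sin (θ - s) ^ 2)
    rw [← sq_abs (Real.sin (θ - s))]
    nlinarith [sq_nonneg (δ - |Real.sin (θ - s)|)]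
  have hv'b : ∀ s, |v' s| ≤ (D s)⁻¹ := fun s => by
    simp only [hv']
    rw [abs_div, abs_of_pos (pow_pos (hD s) 2), div_le_iff₀ (pow_pos (hD s) 2), abs_mul, abs_neg,
      pow_two (D s), inv_mul_cancel_left₀ (hD s).ne']
    have h1 : |δ ^ 2 - Real.sin (θ - s) ^ 2| ≤ D s := by
      rw [abs_le]; simp only [hDdef]
      constructor <;> nlinarith [sq_nonneg δ, sq_nonneg (Real.sin (θ - s))]
    calc _ ≤ 1 * D s := mul_le_mul (Real.abs_cos_le_one _) h1 (abs_nonneg _) zero_le_one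
      _ = _ := one_mul _
  set P : ℝ → ℂ := fun s => E s * v s * g s with hP
  set Q : ℝ → ℂ := fun s => (E s * (Complex.I * lam * Real.sin (θ - s)) * v s + E s * v' s) * g s
    + E s * v s * g' s with hQ
  have hPd : ∀ s, HasDerivAt P (Q s) s := fun s =>
    ((hEd s).mul (hvd s).ofReal_comp).mul (hg s)
  have hQc : Continuous Q := by fun_prop
  have hQ0 : ∫ s in (0:ℝ)..(2 * π), Q s = 0 := by
    rw [integral_eq_sub_of_hasDerivAt (fun s _ => hPd s) (hQc.intervalIntegrable _ _), sub_eq_zero]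
    have h := hper 0
    rw [zero_add] at h
    simp [hP, hE, hv, hDdef, h, Complex.sin_periodic.sub_eq, Complex.cos_sub_two_pi]
  have hlam0 : (lam : ℂ) ≠ 0 := by exact_mod_cast hlam.ne'
  have key : ∀ s, E s * g s - (Complex.I * lam)⁻¹ * Q s =
      (((δ ^ 2 * (D s)⁻¹ : ℝ) : ℂ) * E s - (Complex.I * lam)⁻¹ * (E s * v' s)) * g s
      - (Complex.I * lam)⁻¹ * (E s * v s * g' s) := fun s => by
    have h1 : Real.sin (θ - s) * v s = 1 - δ ^ 2 * (D s)⁻¹ := by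
      have h : D s * (D s)⁻¹ = 1 := mul_inv_cancel₀ (hD s).ne'
      simp only [hv, hDdef] at h ⊢
      linear_combination h
    have h2 : (Real.sin (θ - s) : ℂ) * v s = 1 - ((δ ^ 2 * (D s)⁻¹ : ℝ) : ℂ) := by
      exact_mod_cast congrArg (fun x : ℝ => (x : ℂ)) h1
    have h3 : (Complex.I * lam)⁻¹ * (Complex.I * lam) = 1 :=
      inv_mul_cancel₀ (mul_ne_zero Complex.I_ne_zero hlam0)
    simp only [hQ]
    linear_combination (-E s * g s * ((Real.sin (θ - s) : ℂ) * v s)) * h3 - E s * g s * h2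
  have hEq : ∫ s in (0:ℝ)..(2 * π), E s * g s =
      ∫ s in (0:ℝ)..(2 * π), (E s * g s - (Complex.I * lam)⁻¹ * Q s) := by
    rw [intervalIntegral.integral_sub, intervalIntegral.integral_const_mul, hQ0, mul_zero, sub_zero]
    all_goals exact Continuous.intervalIntegrable (by fun_prop) _ _
  rw [hEq, ← intervalIntegral.integral_const_mul, ← intervalIntegral.integral_const_mul,
    ← intervalIntegral.integral_add]
  rotate_left
  · exact Continuous.intervalIntegrable (by fun_prop) _ _
  · exact Continuous.intervalIntegrable (by fun_prop) _ _
  refine intervalIntegral.norm_integral_le_of_norm_le (by positivity)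
    (Filter.Eventually.of_forall fun s _ => ?_) (Continuous.intervalIntegrable (by fun_prop) _ _)
  rw [key s]
  have hIl : ‖(Complex.I * (lam : ℂ))⁻¹‖ = 1 / lam := by
    simp [abs_of_pos hlam]
  have hn1 : ‖((δ ^ 2 * (D s)⁻¹ : ℝ) : ℂ) * E s‖ = δ ^ 2 * (D s)⁻¹ := by
    rw [norm_mul, hEn, mul_one, Complex.norm_real, Real.norm_of_nonneg]
    have := hD s
    positivity
  have hn2 : ‖(Complex.I * (lam : ℂ))⁻¹ * (E s * v' s)‖ ≤ 1 / lam * (D s)⁻¹ := by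
    rw [norm_mul, norm_mul, hEn, one_mul, hIl, Complex.norm_real, Real.norm_eq_abs]
    gcongr
    exact hv'b s
  have hn3 : ‖(Complex.I * (lam : ℂ))⁻¹ * (E s * v s * g' s)‖ ≤ 1 / (2 * δ * lam) * ‖g' s‖ := by
    rw [norm_mul, norm_mul, norm_mul, hEn, one_mul, hIl, Complex.norm_real, Real.norm_eq_abs]
    calc _ ≤ 1 / lam * (1 / (2 * δ) * ‖g' s‖) := by gcongr; exact hvb s
      _ = _ := by field_simp
  refine (norm_sub_le _ _).trans (add_le_add ?_ hn3)
  rw [norm_mul, ← mul_assoc (δ ^ 2 + 1 / lam), add_mul]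
  exact mul_le_mul_of_nonneg_right ((norm_sub_le _ _).trans (add_le_add hn1.le hn2))
    (norm_nonneg _)

/-- Young's inequality `‖w * h‖₂ ≤ ‖w‖₁ ‖h‖₂` for convolution on the circle. -/
theorem integral_sq_convolution_le {T : ℝ} (hT : 0 < T) {w h : ℝ → ℝ} (hw : Continuous w)
    (hh : Continuous h) (hw0 : ∀ x, 0 < w x) (hper : Function.Periodic w T) :
    ∫ θ in (0:ℝ)..T, (∫ s in (0:ℝ)..T, w (θ - s) * h s) ^ 2 ≤
      (∫ u in (0:ℝ)..T, w u) ^ 2 * ∫ s in (0:ℝ)..T, h s ^ 2 := by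
  have hleft : ∀ θ, ∫ s in (0:ℝ)..T, w (θ - s) = ∫ u in (0:ℝ)..T, w u := fun θ => by
    rw [integral_comp_sub_left]
    convert hper.intervalIntegral_add_eq (θ - T) 0 using 2 <;> ring
  have hright : ∀ s, ∫ θ in (0:ℝ)..T, w (θ - s) = ∫ u in (0:ℝ)..T, w u := fun s => by
    rw [integral_comp_sub_right]
    convert hper.intervalIntegral_add_eq (0 - s) 0 using 2 <;> ring
  have hA : 0 < ∫ u in (0:ℝ)..T, w u :=
    intervalIntegral_pos_of_pos (hw.intervalIntegrable _ _) hw0 hT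
  set A := ∫ u in (0:ℝ)..T, w u
  have hc1 : Continuous fun θ => ∫ s in (0:ℝ)..T, w (θ - s) * h s :=
    continuous_parametric_intervalIntegral_of_continuous' (by fun_prop) _ _
  have hc2 : Continuous fun θ => ∫ s in (0:ℝ)..T, w (θ - s) * h s ^ 2 :=
    continuous_parametric_intervalIntegral_of_continuous' (by fun_prop) _ _
  have hF : Continuous (Function.uncurry fun θ s => w (θ - s) * h s ^ 2) := by fun_prop
  calc _ ≤ ∫ θ in (0:ℝ)..T, A * ∫ s in (0:ℝ)..T, w (θ - s) * h s ^ 2 := by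
        refine integral_mono_on hT.le ((hc1.pow 2).intervalIntegrable _ _)
          ((hc2.const_mul A).intervalIntegrable _ _) fun θ _ => ?_
        have := sq_integral_mul_le hT.le (w := fun s => w (θ - s)) (by fun_prop) hh
          (fun s => (hw0 _).le) (by rwa [hleft θ])
        rwa [hleft θ] at this
    _ = A * ∫ s in (0:ℝ)..T, ∫ θ in (0:ℝ)..T, w (θ - s) * h s ^ 2 := by
        rw [intervalIntegral.integral_const_mul, intervalIntegral_intervalIntegral_swap]
        exact (hF.continuousOn.integrableOn_compact (isCompact_uIcc.prod isCompact_uIcc)).mono_set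
          (Set.prod_mono Set.uIoc_subset_uIcc Set.uIoc_subset_uIcc)
    _ = _ := by
        simp_rw [intervalIntegral.integral_mul_const, hright, intervalIntegral.integral_const_mul]
        ring

/-- The pointwise estimate behind `oscillatory_operator_two_term_estimate`. -/
theorem norm_integral_exp_cos_mul_mul_le {lam δ M : ℝ} (hlam : 0 < lam) (hδ : 0 < δ) (θ : ℝ)
    {a a' φ : ℝ → ℂ} (ha : ∀ s, HasDerivAt a (a' s) s) (ha' : Continuous a')
    (haper : Function.Periodic a (2 * π)) (hφ : ContDiff ℝ 1 φ)
    (hφper : Function.Periodic φ (2 * π)) (haM : ∀ s ∈ Set.Icc 0 (2 * π), ‖a s‖ ≤ M)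
    (haM' : ∀ s ∈ Set.Icc 0 (2 * π), ‖a' s‖ ≤ M) :
    ‖∫ s in (0:ℝ)..(2 * π), Complex.exp (Complex.I * lam * Real.cos (θ - s)) * (a s * φ s)‖ ≤
      M * (δ ^ 2 + 1 / lam) *
          (∫ s in (0:ℝ)..(2 * π), (δ ^ 2 + Real.sin (θ - s) ^ 2)⁻¹ * ‖φ s‖) +
        M / (2 * δ * lam) * ∫ s in (0:ℝ)..(2 * π), (‖φ s‖ + ‖deriv φ s‖) := by
  have h2pi : 0 ≤ 2 * π := by positivity
  have hac : Continuous a := continuous_iff_continuousAt.2 fun s => (ha s).continuousAt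
  have hφc := hφ.continuous
  have hφ'c : Continuous (deriv φ) := hφ.continuous_deriv le_rfl
  have hφd : ∀ s, HasDerivAt φ (deriv φ s) s := fun s =>
    (hφ.differentiable one_ne_zero s).hasDerivAt
  have hDi : Continuous fun s => (δ ^ 2 + Real.sin (θ - s) ^ 2)⁻¹ :=
    Continuous.inv₀ (by fun_prop) fun s => by positivity
  refine (norm_integral_exp_cos_mul_le hlam hδ θ (fun s => (ha s).mul (hφd s))
    (by fun_prop) (haper.mul hφper)).trans (add_le_add ?_ ?_)
  · rw [mul_comm M, mul_assoc, ← intervalIntegral.integral_const_mul M]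
    gcongr
    refine integral_mono_on h2pi (Continuous.intervalIntegrable (by fun_prop) _ _)
      (Continuous.intervalIntegrable (by fun_prop) _ _) fun s hs => ?_
    rw [Pi.mul_apply, norm_mul, mul_left_comm M]
    gcongr
    exact haM s hs
  · rw [div_eq_mul_one_div M, mul_comm M, mul_assoc (1 / _), ← intervalIntegral.integral_const_mul M]
    gcongr
    refine integral_mono_on h2pi (Continuous.intervalIntegrable (by fun_prop) _ _)
      (Continuous.intervalIntegrable (by fun_prop) _ _) fun s hs => (norm_add_le _ _).trans ?_
    rw [norm_mul, norm_mul, mul_add]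
    gcongr
    · exact haM' s hs
    · exact haM s hs

/-- Intermediate two-term estimate for the oscillatory integral operator with kernel
`e^{2ikR cos(θ-s)} ℓ(θ,s)`: for `C¹` doubly `2π`-periodic `ℓ` there is `C > 0` such that
for all `R ≥ 1`, all `δ ∈ (0, π/2)` with `2 sin δ ≥ δ` and all `C¹` `2π`-periodic `φ`,
the `L²`-norm in `θ` of `∫_0^{2π} e^{2ikR cos(θ-s)} ℓ(θ,s) φ(s) ds` is at most
`C (δ ‖φ‖_{L²} + (Rδ)⁻¹ ‖φ‖_{H¹})`. -/
theorem oscillatory_operator_two_term_estimate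
    (k : ℝ) (hk : 0 < k) (ℓ : ℝ → ℝ → ℂ)
    (hℓ : ContDiff ℝ 1 (fun p : ℝ × ℝ => ℓ p.1 p.2))
    (hℓper1 : ∀ θ s, ℓ (θ + 2 * π) s = ℓ θ s)
    (hℓper2 : ∀ θ s, ℓ θ (s + 2 * π) = ℓ θ s) :
    ∃ C > 0, ∀ R : ℝ, 1 ≤ R → ∀ δ : ℝ, 0 < δ → δ < π / 2 → δ ≤ 2 * Real.sin δ →
      ∀ φ : ℝ → ℂ, ContDiff ℝ 1 φ → Function.Periodic φ (2 * π) →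
        Real.sqrt (∫ θ in (0:ℝ)..(2 * π),
            ‖∫ s in (0:ℝ)..(2 * π),
                Complex.exp (2 * Complex.I * k * R * Real.cos (θ - s)) * ℓ θ s * φ s‖ ^ 2)
          ≤ C * (δ * Real.sqrt (∫ s in (0:ℝ)..(2 * π), ‖φ s‖ ^ 2)
              + 1 / (R * δ) *
                Real.sqrt (∫ s in (0:ℝ)..(2 * π), (‖φ s‖ ^ 2 + ‖deriv φ s‖ ^ 2))) := by
  have hpi := Real.pi_pos
  have h2pi : 0 < 2 * π := by positivity
  set L : ℝ × ℝ → ℂ := fun p => ℓ p.1 p.2 with hL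
  have hLc : Continuous L := hℓ.continuous
  set L' : ℝ × ℝ → ℂ := fun p => fderiv ℝ L p (0, 1) with hL'
  have hL'c : Continuous L' := (hℓ.continuous_fderiv one_ne_zero).clm_apply continuous_const
  have hLd : ∀ θ s, HasDerivAt (fun s => ℓ θ s) (L' (θ, s)) s := fun θ s =>
    ((hℓ.differentiable one_ne_zero (θ, s)).hasFDerivAt).comp_hasDerivAt s
      ((hasDerivAt_const s θ).prodMk (hasDerivAt_id s))
  have hcomp : IsCompact (Set.Icc (0:ℝ) (2 * π) ×ˢ Set.Icc (0:ℝ) (2 * π)) :=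
    isCompact_Icc.prod isCompact_Icc
  obtain ⟨M₁, hM₁⟩ := hcomp.exists_bound_of_continuousOn hLc.continuousOn
  obtain ⟨M₂, hM₂⟩ := hcomp.exists_bound_of_continuousOn hL'c.continuousOn
  set M := max (max M₁ M₂) 1
  have hM : 0 < M := lt_of_lt_of_le one_pos (le_max_right _ _)
  have hM1 : M₁ ≤ M := (le_max_left _ _).trans (le_max_left _ _)
  have hM2 : M₂ ≤ M := (le_max_right _ _).trans (le_max_left _ _)
  refine ⟨2 * π ^ 2 * M + (π ^ 2 + π) * M / k, by positivity, ?_⟩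
  intro R hR δ hδ _ _ φ hφ hφper
  have hR0 : 0 < R := one_pos.trans_le hR
  have hφc := hφ.continuous
  have hφ'c : Continuous (deriv φ) := hφ.continuous_deriv le_rfl
  have hlam : 0 < 2 * k * R := by positivity
  set w : ℝ → ℝ := fun u => (δ ^ 2 + Real.sin u ^ 2)⁻¹ with hw
  have hw0 : ∀ u, 0 < w u := fun u => by positivity
  have hwc : Continuous w := Continuous.inv₀ (by fun_prop) fun u => by positivity
  have hwper : Function.Periodic w (2 * π) := fun u => by simp [hw]
  set N := ∫ s in (0:ℝ)..(2 * π), ‖φ s‖ ^ 2 with hN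
  set H := ∫ s in (0:ℝ)..(2 * π), (‖φ s‖ ^ 2 + ‖deriv φ s‖ ^ 2) with hH
  have hN0 : 0 ≤ N := integral_nonneg h2pi.le fun s _ => by positivity
  have hNH : N ≤ H := integral_mono_on h2pi.le (Continuous.intervalIntegrable (by fun_prop) _ _)
    (Continuous.intervalIntegrable (by fun_prop) _ _) fun s _ => by
      have := sq_nonneg ‖deriv φ s‖
      linarith
  have hH0 : 0 ≤ H := hN0.trans hNH
  set G : ℝ → ℝ := fun θ => ∫ s in (0:ℝ)..(2 * π), w (θ - s) * ‖φ s‖ with hG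
  have hGc : Continuous G :=
    continuous_parametric_intervalIntegral_of_continuous' (by fun_prop) _ _
  have hG2 : ∫ θ in (0:ℝ)..(2 * π), G θ ^ 2 ≤ (π ^ 2 / δ) ^ 2 * N := by
    refine (integral_sq_convolution_le h2pi hwc hφc.norm hw0 hwper).trans ?_
    have h0 : 0 ≤ ∫ u in (0:ℝ)..(2 * π), w u := integral_nonneg h2pi.le fun u _ => (hw0 u).le
    gcongr
    exact integral_inv_sq_add_sin_sq_le hδ
  set J := ∫ s in (0:ℝ)..(2 * π), (‖φ s‖ + ‖deriv φ s‖) with hJ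
  have hJ2 : J ^ 2 ≤ 4 * π * H := by
    have h1 := sq_integral_mul_le h2pi.le (w := fun _ => 1)
      (h := fun s => ‖φ s‖ + ‖deriv φ s‖) continuous_const (by fun_prop) (fun _ => zero_le_one)
      (by simpa using hpi)
    simp only [one_mul, intervalIntegral.integral_const, sub_zero, smul_eq_mul, mul_one] at h1
    have h2 : ∫ s in (0:ℝ)..(2 * π), (‖φ s‖ + ‖deriv φ s‖) ^ 2 ≤ 2 * H := by
      rw [hH, ← intervalIntegral.integral_const_mul]
      refine integral_mono_on h2pi.le (Continuous.intervalIntegrable (by fun_prop) _ _)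
        (Continuous.intervalIntegrable (by fun_prop) _ _) fun s _ => ?_
      nlinarith [sq_nonneg (‖φ s‖ - ‖deriv φ s‖)]
    calc J ^ 2 ≤ _ := h1
      _ ≤ 2 * π * (2 * H) := by gcongr
      _ = _ := by ring
  set a := M * (δ ^ 2 + 1 / (2 * k * R)) with ha
  set b := M / (2 * δ * (2 * k * R)) with hb
  have ha0 : 0 < a := by positivity
  have hb0 : 0 < b := by positivity
  have hpt : ∀ θ ∈ Set.Icc (0:ℝ) (2 * π), ‖∫ s in (0:ℝ)..(2 * π),
      Complex.exp (2 * Complex.I * k * R * Real.cos (θ - s)) * ℓ θ s * φ s‖ ≤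
      a * G θ + b * J := fun θ hθ => by
    have h := norm_integral_exp_cos_mul_mul_le (M := M) hlam hδ θ (hLd θ) (by fun_prop)
      (fun s => hℓper2 θ s) hφ hφper (fun s hs => (hM₁ (θ, s) ⟨hθ, hs⟩).trans hM1)
      (fun s hs => (hM₂ (θ, s) ⟨hθ, hs⟩).trans hM2)
    refine le_trans (le_of_eq ?_) h
    congr 2
    funext s
    rw [mul_assoc]
    congr 3
    push_cast
    ring
  have hint : ∫ θ in (0:ℝ)..(2 * π), ‖∫ s in (0:ℝ)..(2 * π),
      Complex.exp (2 * Complex.I * k * R * Real.cos (θ - s)) * ℓ θ s * φ s‖ ^ 2 ≤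
      2 * a ^ 2 * ((π ^ 2 / δ) ^ 2 * N) + 4 * π * b ^ 2 * (4 * π * H) := by
    have hTc : Continuous fun θ => ∫ s in (0:ℝ)..(2 * π),
        Complex.exp (2 * Complex.I * k * R * Real.cos (θ - s)) * ℓ θ s * φ s := by
      refine continuous_parametric_intervalIntegral_of_continuous' ?_ _ _
      have : Continuous fun p : ℝ × ℝ => ℓ p.1 p.2 := hLc
      fun_prop
    calc _ ≤ ∫ θ in (0:ℝ)..(2 * π), (2 * a ^ 2 * G θ ^ 2 + 2 * b ^ 2 * J ^ 2) := by
          refine integral_mono_on h2pi.le (Continuous.intervalIntegrable (by fun_prop) _ _)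
            (Continuous.intervalIntegrable (by fun_prop) _ _) fun θ hθ => ?_
          refine (pow_le_pow_left₀ (norm_nonneg _) (hpt θ hθ) 2).trans ?_
          nlinarith [sq_nonneg (a * G θ - b * J)]
      _ = 2 * a ^ 2 * (∫ θ in (0:ℝ)..(2 * π), G θ ^ 2) + 4 * π * b ^ 2 * J ^ 2 := by
          rw [intervalIntegral.integral_add, intervalIntegral.integral_const_mul,
            intervalIntegral.integral_const, smul_eq_mul]
          · ring
          all_goals exact Continuous.intervalIntegrable (by fun_prop) _ _
      _ ≤ _ := by gcongr
  have hsN := Real.sq_sqrt hN0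
  have hsH := Real.sq_sqrt hH0
  have hsNH : √N ≤ √H := Real.sqrt_le_sqrt hNH
  have hsN0 := Real.sqrt_nonneg N
  have hsH0 := Real.sqrt_nonneg H
  calc _ ≤ √((2 * a * (π ^ 2 / δ) * √N + 4 * π * b * √H) ^ 2) := by
        refine Real.sqrt_le_sqrt (hint.trans ?_)
        have h1 : 0 ≤ (a * (π ^ 2 / δ)) ^ 2 * N := by positivity
        have h2 : 0 ≤ (2 * a * (π ^ 2 / δ) * √N) * (4 * π * b * √H) := by positivity
        calc _ = 2 * ((a * (π ^ 2 / δ)) ^ 2 * N) + (4 * π * b) ^ 2 * H := by ring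
          _ ≤ 4 * ((a * (π ^ 2 / δ)) ^ 2 * N) + (4 * π * b) ^ 2 * H
              + 2 * ((2 * a * (π ^ 2 / δ) * √N) * (4 * π * b * √H)) := by linarith
          _ = 4 * ((a * (π ^ 2 / δ)) ^ 2 * √N ^ 2) + (4 * π * b) ^ 2 * √H ^ 2
              + 2 * ((2 * a * (π ^ 2 / δ) * √N) * (4 * π * b * √H)) := by rw [hsN, hsH]
          _ = _ := by ring
    _ = 2 * a * (π ^ 2 / δ) * √N + 4 * π * b * √H := Real.sqrt_sq (by positivity)
    _ = 2 * π ^ 2 * M * (δ * √N) + π ^ 2 * M / k * (1 / (R * δ) * √N)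
          + π * M / k * (1 / (R * δ) * √H) := by
        rw [ha, hb]
        field_simp
        ring
    _ ≤ 2 * π ^ 2 * M * (δ * √N) + π ^ 2 * M / k * (1 / (R * δ) * √H)
          + π * M / k * (1 / (R * δ) * √H) := by gcongr
    _ ≤ _ := by
        have h1 : 0 ≤ 2 * π ^ 2 * M * (1 / (R * δ) * √H) := by positivity
        have h2 : 0 ≤ (π ^ 2 + π) * M / k * (δ * √N) := by positivity
        have h3 : (π ^ 2 + π) * M / k = π ^ 2 * M / k + π * M / k := by ring
        rw [h3] at h2 ⊢
        linarith
end

section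
/- Let $k > 0$ and let $\ell \colon \mathbb{R} \times \mathbb{R} \to \mathbb{C}$ be continuously differentiable and $2\pi$-periodic in each of its two variables. Then there exists a constant $C > 0$ (depending only on $k$ and $\ell$) such that for every $R \ge 1$ and every continuously differentiable $2\pi$-periodic function $\psi \colon \mathbb{R} \to \mathbb{C}$, $\left( \int_0^{2\pi} \left| \int_0^{2\pi} e^{-2 i k R \cos(\theta - s)}\, \ell(\theta, s)\, \psi(\theta)\, d\theta \right|^2 ds \right)^{1/2} \le \frac{C}{R^{1/2}} \left( \int_0^{2\pi} \left( |\psi(\theta)|^2 + |\psi'(\theta)|^2 \right) d\theta \right)^{1/2}$. -/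
open MeasureTheory intervalIntegral Real

lemma cos_sq_add_mul_sin_sq_pos {b : ℝ} (hb : 0 < b) (t : ℝ) :
    0 < cos t ^ 2 + b * sin t ^ 2 := by
  rcases eq_or_ne (sin t) 0 with h | h
  · have := sin_sq_add_cos_sq t
    rw [h] at this ⊢
    nlinarith
  · positivity

/-- The function `t + arctan ((a - 1) sin t cos t / (cos² t + a sin² t))` is the continuous branch
of `arctan (a tan t)`. -/
lemma hasDerivAt_add_arctan_mul_tan {a : ℝ} (ha : 0 < a) (t : ℝ) :
    HasDerivAt (fun t => t + arctan ((a - 1) * (sin t * cos t) / (cos t ^ 2 + a * sin t ^ 2)))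
      (a / (cos t ^ 2 + a ^ 2 * sin t ^ 2)) t := by
  have hM := cos_sq_add_mul_sin_sq_pos ha t
  have hD := cos_sq_add_mul_sin_sq_pos (pow_pos ha 2) t
  have h1 := ((hasDerivAt_sin t).mul (hasDerivAt_cos t)).const_mul (a - 1)
  have h2 := ((hasDerivAt_cos t).pow 2).add (((hasDerivAt_sin t).pow 2).const_mul a)
  have h := (hasDerivAt_id t).add (h1.div h2 hM.ne').arctan
  refine h.congr_deriv ?_
  have hsum : (cos t ^ 2 + a * sin t ^ 2) ^ 2 + ((a - 1) * (sin t * cos t)) ^ 2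
      = cos t ^ 2 + a ^ 2 * sin t ^ 2 := by
    linear_combination (cos t ^ 2 + a ^ 2 * sin t ^ 2) * sin_sq_add_cos_sq t
  simp only [Pi.mul_apply, Pi.add_apply, Pi.pow_apply, Pi.div_apply]
  have hkey : 1 + ((a - 1) * (sin t * cos t) / (cos t ^ 2 + a * sin t ^ 2)) ^ 2
      = (cos t ^ 2 + a ^ 2 * sin t ^ 2) / (cos t ^ 2 + a * sin t ^ 2) ^ 2 := by
    rw [← hsum]
    field_simp
  rw [hkey]
  field_simp
  have hs : cos t ^ 2 = 1 - sin t ^ 2 := cos_sq' t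
  have hs4 : cos t ^ 4 = (1 - sin t ^ 2) ^ 2 := by rw [← hs]; ring
  push_cast
  ring_nf
  simp only [hs, hs4]
  ring

lemma integral_inv_sin_sq_add_le {ε : ℝ} (hε : 0 < ε) {x y : ℝ} (hxy : x ≤ y) :
    ∫ t in x..y, (sin t ^ 2 + ε ^ 2)⁻¹ ≤ (y - x + π) / ε := by
  have hD : ∀ t : ℝ, 0 < cos t ^ 2 + ε⁻¹ ^ 2 * sin t ^ 2 :=
    cos_sq_add_mul_sin_sq_pos (by positivity)
  have hcont : Continuous fun t : ℝ => ε⁻¹ / (cos t ^ 2 + ε⁻¹ ^ 2 * sin t ^ 2) :=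
    continuous_const.div (by fun_prop) fun t => (hD t).ne'
  have hint := integral_eq_sub_of_hasDerivAt (a := x) (b := y)
    (fun t _ => hasDerivAt_add_arctan_mul_tan (inv_pos.2 hε) t) (hcont.intervalIntegrable _ _)
  calc ∫ t in x..y, (sin t ^ 2 + ε ^ 2)⁻¹
      ≤ ∫ t in x..y, ε⁻¹ * (ε⁻¹ / (cos t ^ 2 + ε⁻¹ ^ 2 * sin t ^ 2)) := by
        refine integral_mono_on hxy ?_ ((hcont.const_mul _).intervalIntegrable _ _) fun t _ => ?_
        · exact ((Continuous.inv₀ (by fun_prop) fun t => by positivity)).intervalIntegrable _ _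
        · have h : ε⁻¹ * (ε⁻¹ / (cos t ^ 2 + ε⁻¹ ^ 2 * sin t ^ 2))
              = (ε ^ 2 * (cos t ^ 2 + ε⁻¹ ^ 2 * sin t ^ 2))⁻¹ := by
            field_simp
          rw [h]
          refine inv_anti₀ (mul_pos (by positivity) (hD t)) ?_
          have : ε ^ 2 * (cos t ^ 2 + ε⁻¹ ^ 2 * sin t ^ 2) = ε ^ 2 * cos t ^ 2 + sin t ^ 2 := by
            field_simp
          nlinarith [cos_sq_le_one t, sq_nonneg ε]
    _ ≤ (y - x + π) / ε := by
        rw [intervalIntegral.integral_const_mul, hint, div_eq_inv_mul (y - x + π)]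
        refine mul_le_mul_of_nonneg_left ?_ (by positivity)
        linarith [arctan_lt_pi_div_two
            ((ε⁻¹ - 1) * (sin y * cos y) / (cos y ^ 2 + ε⁻¹ * sin y ^ 2)),
          neg_pi_div_two_lt_arctan
            ((ε⁻¹ - 1) * (sin x * cos x) / (cos x ^ 2 + ε⁻¹ * sin x ^ 2))]

/-- Van der Corput estimate for the phase `cos`, obtained by integrating by parts against the
regularised weight `sin t / (sin² t + ε²)` with `ε = λ^{-1/2}`. -/
lemma norm_integral_exp_mul_cos_le {r : ℝ} (hr : 0 < r) {x y : ℝ} (hxy : x ≤ y) :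
    ‖∫ t in x..y, Complex.exp (-(Complex.I * r * cos t))‖
      ≤ (2 * (y - x + π) + 1) / √r := by
  set ε : ℝ := (√r)⁻¹ with hεdef
  have hε : 0 < ε := by positivity
  have hrε : r * ε ^ 2 = 1 := by
    rw [hεdef, inv_pow, sq_sqrt hr.le, mul_inv_cancel₀ hr.ne']
  have hD : ∀ t : ℝ, 0 < sin t ^ 2 + ε ^ 2 := fun t => by positivity
  let E : ℝ → ℂ := fun t => Complex.exp (-(Complex.I * r * cos t))
  have hEnorm : ∀ t, ‖E t‖ = 1 := fun t => by
    simp only [E, Complex.norm_exp]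
    simp
  have hEcont : Continuous E := by fun_prop
  have hE : ∀ t, HasDerivAt E (E t * (Complex.I * r * sin t)) t := fun t => by
    have h := (((hasDerivAt_cos t).ofReal_comp).const_mul (Complex.I * r)).neg.cexp
    refine h.congr_deriv ?_
    simp only [E, Pi.neg_apply]
    push_cast
    ring
  let w : ℝ → ℝ := fun t => sin t / (sin t ^ 2 + ε ^ 2)
  let w' : ℝ → ℝ := fun t => cos t * (ε ^ 2 - sin t ^ 2) / (sin t ^ 2 + ε ^ 2) ^ 2
  have hw : ∀ t, HasDerivAt w (w' t) t := fun t => by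
    have h := (hasDerivAt_sin t).div (((hasDerivAt_sin t).pow 2).add_const (ε ^ 2)) (hD t).ne'
    refine h.congr_deriv ?_
    simp only [w', Pi.pow_apply]
    congr 1
    push_cast
    ring
  have hw'cont : Continuous w' :=
    Continuous.div (by fun_prop) (by fun_prop) fun t => (pow_pos (hD t) 2).ne'
  have hwle : ∀ t, ‖E t * w t‖ ≤ (2 * ε)⁻¹ := fun t => by
    rw [norm_mul, hEnorm, one_mul, Complex.norm_real, norm_eq_abs, abs_div, abs_of_pos (hD t),
      div_le_iff₀ (hD t), inv_mul_eq_div, le_div_iff₀ (by positivity)]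
    nlinarith [sq_nonneg (|sin t| - ε), sq_abs (sin t)]
  have hw'le : ∀ t, |w' t| ≤ (sin t ^ 2 + ε ^ 2)⁻¹ := fun t => by
    rw [abs_div, abs_of_pos (pow_pos (hD t) 2), div_le_iff₀ (pow_pos (hD t) 2), abs_mul]
    have h1 : (sin t ^ 2 + ε ^ 2)⁻¹ * (sin t ^ 2 + ε ^ 2) ^ 2 = sin t ^ 2 + ε ^ 2 := by
      field_simp
    have h2 : |ε ^ 2 - sin t ^ 2| ≤ sin t ^ 2 + ε ^ 2 :=
      abs_le.2 ⟨by nlinarith [sq_nonneg ε], by nlinarith [sq_nonneg (sin t)]⟩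
    rw [h1]
    calc |cos t| * |ε ^ 2 - sin t ^ 2| ≤ 1 * (sin t ^ 2 + ε ^ 2) :=
          mul_le_mul (abs_cos_le_one t) h2 (abs_nonneg _) zero_le_one
      _ = _ := one_mul _
  let q : ℝ → ℂ := fun t => E t * ((w' t : ℂ) + Complex.I * ((sin t ^ 2 + ε ^ 2)⁻¹ : ℝ) * (-1))
  have hinvcont : Continuous fun t : ℝ => (sin t ^ 2 + ε ^ 2)⁻¹ :=
    Continuous.inv₀ (by fun_prop) fun t => (hD t).ne'
  have hqcont : Continuous q := by
    have := Complex.continuous_ofReal.comp hinvcont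
    have := Complex.continuous_ofReal.comp hw'cont
    simp only [Function.comp_def] at *
    fun_prop
  have hderiv : ∀ t, HasDerivAt (fun t => E t * w t) (q t + Complex.I * r * E t) t := fun t => by
    refine ((hE t).mul (hw t).ofReal_comp).congr_deriv ?_
    have h1 : r * sin t * w t = r - (sin t ^ 2 + ε ^ 2)⁻¹ := by
      simp only [w]
      have := (hD t).ne'
      field_simp
      linear_combination -hrε
    have h2 : (r : ℂ) * sin t * w t = r - ((sin t ^ 2 + ε ^ 2)⁻¹ : ℝ) := by
      exact_mod_cast h1
    simp only [q]
    linear_combination (E t * Complex.I) * h2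
  have hqle : ∀ t, ‖q t‖ ≤ 2 * (sin t ^ 2 + ε ^ 2)⁻¹ := fun t => by
    simp only [q]
    rw [norm_mul, hEnorm, one_mul]
    refine (norm_add_le _ _).trans ?_
    rw [norm_mul, norm_mul, Complex.norm_I, Complex.norm_real, Complex.norm_real, norm_neg,
      norm_one, norm_eq_abs, norm_eq_abs, abs_of_pos (inv_pos.2 (hD t))]
    linarith [hw'le t]
  have hftc := integral_eq_sub_of_hasDerivAt (a := x) (b := y) (fun t _ => hderiv t)
    (Continuous.intervalIntegrable (by fun_prop) _ _)
  rw [integral_add (hqcont.intervalIntegrable _ _)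
    (Continuous.intervalIntegrable (by fun_prop) _ _), intervalIntegral.integral_const_mul] at hftc
  have hqint : ‖∫ t in x..y, q t‖ ≤ 2 * ((y - x + π) / ε) :=
    calc ‖∫ t in x..y, q t‖ ≤ ∫ t in x..y, 2 * (sin t ^ 2 + ε ^ 2)⁻¹ :=
          norm_integral_le_of_norm_le hxy (Filter.Eventually.of_forall fun t _ => hqle t)
            ((hinvcont.const_mul 2).intervalIntegrable _ _)
      _ ≤ _ := by
          rw [intervalIntegral.integral_const_mul]
          exact mul_le_mul_of_nonneg_left (integral_inv_sin_sq_add_le hε hxy) zero_le_two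
  have hmain : r * ‖∫ t in x..y, E t‖ ≤ (2 * (y - x + π) + 1) / ε := by
    have h : Complex.I * r * ∫ t in x..y, E t
        = E y * w y - E x * w x - ∫ t in x..y, q t := by
      linear_combination hftc
    have hn := congrArg norm h
    rw [norm_mul, norm_mul, Complex.norm_I, one_mul, Complex.norm_real, norm_eq_abs,
      abs_of_pos hr] at hn
    rw [hn]
    refine (norm_sub_le _ _).trans ((add_le_add (norm_sub_le _ _) le_rfl).trans
      ((add_le_add (add_le_add (hwle y) (hwle x)) hqint).trans_eq ?_))
    field_simp
    ring
  have hfin : (2 * (y - x + π) + 1) / √r = (2 * (y - x + π) + 1) / ε / r := by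
    rw [div_eq_mul_inv, ← hεdef]
    field_simp
    linear_combination (2 * (y - x + π) + 1) * hrε
  rw [hfin, le_div_iff₀' hr]
  exact hmain

lemma norm_integral_mul_le_of_norm_primitive_le {φ g : ℝ → ℂ} (hφ : Continuous φ)
    (hg : ContDiff ℝ 1 g) {L B : ℝ} (hL : 0 ≤ L)
    (hB : ∀ x ∈ Set.Icc 0 L, ‖∫ t in (0:ℝ)..x, φ t‖ ≤ B) :
    ‖∫ t in (0:ℝ)..L, φ t * g t‖ ≤ B * (‖g L‖ + ∫ t in (0:ℝ)..L, ‖deriv g t‖) := by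
  have hg' : Continuous (deriv g) := hg.continuous_deriv le_rfl
  have hibp := integral_deriv_mul_eq_sub (a := 0) (b := L)
    (u := fun x => ∫ t in (0:ℝ)..x, φ t) (v := g) (u' := φ) (v' := deriv g)
    (fun x _ => hφ.integral_hasStrictDerivAt 0 x |>.hasDerivAt)
    (fun x _ => (hg.differentiable one_ne_zero x).hasDerivAt)
    (hφ.intervalIntegrable _ _) (hg'.intervalIntegrable _ _)
  have hΦ : Continuous fun x => ∫ t in (0:ℝ)..x, φ t :=
    continuous_primitive (fun a b => hφ.intervalIntegrable a b) 0
  have hgc := hg.continuous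
  rw [integral_add (Continuous.intervalIntegrable (by fun_prop) _ _)
    (Continuous.intervalIntegrable (by fun_prop) _ _), integral_same, zero_mul, sub_zero] at hibp
  rw [eq_sub_of_add_eq hibp, mul_add]
  refine (norm_sub_le _ _).trans (add_le_add ?_ ?_)
  · rw [norm_mul]
    exact mul_le_mul_of_nonneg_right (hB L ⟨hL, le_rfl⟩) (norm_nonneg _)
  · rw [← intervalIntegral.integral_const_mul]
    refine norm_integral_le_of_norm_le hL (Filter.Eventually.of_forall fun t ht => ?_)
      ((hg'.norm.const_mul B).intervalIntegrable _ _)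
    rw [norm_mul]
    exact mul_le_mul_of_nonneg_right (hB t ⟨ht.1.le, ht.2⟩) (norm_nonneg _)

lemma norm_le_integral_norm_add_norm_deriv {ψ : ℝ → ℂ} (hψ : ContDiff ℝ 1 ψ) {L : ℝ}
    (hL : 1 ≤ L) : ‖ψ L‖ ≤ ∫ t in (0:ℝ)..L, (‖ψ t‖ + ‖deriv ψ t‖) := by
  have hL0 : 0 < L := by linarith
  have hψ' : Continuous (deriv ψ) := hψ.continuous_deriv le_rfl
  have hc := hψ.continuous
  have hd : ∀ t : ℝ, HasDerivAt (fun t : ℝ => (t : ℂ) * ψ t) (1 * ψ t + t * deriv ψ t) t :=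
    fun t => (hasDerivAt_id t).ofReal_comp.mul (hψ.differentiable one_ne_zero t).hasDerivAt
  have h := integral_eq_sub_of_hasDerivAt (a := 0) (b := L) (fun t _ => hd t)
    (Continuous.intervalIntegrable (by fun_prop) _ _)
  have hle : ‖∫ t in (0:ℝ)..L, (1 * ψ t + t * deriv ψ t)‖
      ≤ ∫ t in (0:ℝ)..L, L * (‖ψ t‖ + ‖deriv ψ t‖) := by
    refine norm_integral_le_of_norm_le hL0.le (Filter.Eventually.of_forall fun t ht => ?_)
      (Continuous.intervalIntegrable (by fun_prop) _ _)
    refine (norm_add_le _ _).trans ?_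
    rw [norm_mul, norm_mul, norm_one, Complex.norm_real, norm_eq_abs, abs_of_pos ht.1, mul_add]
    gcongr
    exact ht.2
  rw [h, intervalIntegral.integral_const_mul, Complex.ofReal_zero, zero_mul, sub_zero, norm_mul,
    Complex.norm_real, norm_eq_abs, abs_of_pos hL0] at hle
  exact le_of_mul_le_mul_left hle hL0

lemma integral_sq_le_mul_integral_sq {h : ℝ → ℝ} (hh : Continuous h) {L : ℝ} (hL : 0 < L) :
    (∫ t in (0:ℝ)..L, h t) ^ 2 ≤ L * ∫ t in (0:ℝ)..L, h t ^ 2 := by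
  set J := ∫ t in (0:ℝ)..L, h t with hJ
  have hnn : 0 ≤ ∫ t in (0:ℝ)..L, (h t - J / L) ^ 2 :=
    integral_nonneg hL.le fun t _ => sq_nonneg _
  have heq : ∫ t in (0:ℝ)..L, (h t - J / L) ^ 2
      = (∫ t in (0:ℝ)..L, h t ^ 2) - 2 * (J / L) * J + L * (J / L) ^ 2 := by
    have : ∀ t, (h t - J / L) ^ 2 = h t ^ 2 - 2 * (J / L) * h t + (J / L) ^ 2 := fun t => by ring
    simp only [this]
    rw [integral_add (Continuous.intervalIntegrable (by fun_prop) _ _)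
        (Continuous.intervalIntegrable (by fun_prop) _ _),
      integral_sub (Continuous.intervalIntegrable (by fun_prop) _ _)
        (Continuous.intervalIntegrable (by fun_prop) _ _), intervalIntegral.integral_const_mul,
      intervalIntegral.integral_const,
      smul_eq_mul, sub_zero]
  rw [heq] at hnn
  have h2 : L * ((∫ t in (0:ℝ)..L, h t ^ 2) - 2 * (J / L) * J + L * (J / L) ^ 2)
      = L * (∫ t in (0:ℝ)..L, h t ^ 2) - J ^ 2 := by
    field_simp
    ring
  nlinarith [mul_nonneg hL.le hnn]

lemma integral_norm_add_norm_le_sqrt {f g : ℝ → ℂ} (hf : Continuous f) (hg : Continuous g)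
    {L : ℝ} (hL : 0 < L) :
    ∫ t in (0:ℝ)..L, (‖f t‖ + ‖g t‖)
      ≤ √(2 * L) * √(∫ t in (0:ℝ)..L, (‖f t‖ ^ 2 + ‖g t‖ ^ 2)) := by
  rw [← sqrt_mul (by positivity)]
  refine le_sqrt_of_sq_le ((integral_sq_le_mul_integral_sq (by fun_prop) hL).trans ?_)
  rw [mul_comm 2 L, mul_assoc, ← intervalIntegral.integral_const_mul 2]
  refine mul_le_mul_of_nonneg_left (integral_mono_on hL.le
    (Continuous.intervalIntegrable (by fun_prop) _ _)
    (Continuous.intervalIntegrable (by fun_prop) _ _) fun t _ => ?_) hL.le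
  nlinarith [sq_nonneg (‖f t‖ - ‖g t‖)]

lemma exists_bound_and_deriv_bound {ℓ : ℝ → ℝ → ℂ}
    (hℓ : ContDiff ℝ 1 (fun p : ℝ × ℝ => ℓ p.1 p.2)) (L : ℝ) :
    ∃ M > 0, ∀ θ ∈ Set.Icc 0 L, ∀ s ∈ Set.Icc 0 L,
      ‖ℓ θ s‖ ≤ M ∧ ‖deriv (fun θ => ℓ θ s) θ‖ ≤ M := by
  have hK : IsCompact (Set.Icc (0:ℝ) L ×ˢ Set.Icc (0:ℝ) L) := isCompact_Icc.prod isCompact_Icc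
  obtain ⟨M₁, h₁⟩ := hK.exists_bound_of_continuousOn hℓ.continuous.continuousOn
  obtain ⟨M₂, h₂⟩ := hK.exists_bound_of_continuousOn (hℓ.continuous_fderiv one_ne_zero).continuousOn
  refine ⟨max 1 (max M₁ M₂), by positivity, fun θ hθ s hs =>
    ⟨(h₁ (θ, s) ⟨hθ, hs⟩).trans (by simp), ?_⟩⟩
  have hd : HasDerivAt (fun θ => ℓ θ s)
      (fderiv ℝ (fun p : ℝ × ℝ => ℓ p.1 p.2) (θ, s) (1, 0)) θ :=
    HasFDerivAt.comp_hasDerivAt (f := fun θ => (θ, s)) θ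
      (hℓ.differentiable one_ne_zero (θ, s)).hasFDerivAt
      ((hasDerivAt_id θ).prodMk (hasDerivAt_const θ s))
  rw [hd.deriv]
  calc ‖fderiv ℝ (fun p : ℝ × ℝ => ℓ p.1 p.2) (θ, s) (1, 0)‖
      ≤ ‖fderiv ℝ (fun p : ℝ × ℝ => ℓ p.1 p.2) (θ, s)‖ * ‖((1:ℝ), (0:ℝ))‖ :=
        ContinuousLinearMap.le_opNorm _ _
    _ ≤ M₂ := by simpa [Prod.norm_def] using h₂ (θ, s) ⟨hθ, hs⟩
    _ ≤ _ := by simp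

/-- Adjoint-side `O(R^{-1/2})` decay estimate (`H¹ → L²`) for the oscillatory integral
operator with kernel `e^{-2ikR cos(θ-s)} ℓ(θ,s)` acting by integration in the first
variable: for `C¹` doubly `2π`-periodic `ℓ` there is `C > 0` such that for all `R ≥ 1`
and all `C¹` `2π`-periodic `ψ`, the `L²`-norm in `s` of
`∫_0^{2π} e^{-2ikR cos(θ-s)} ℓ(θ,s) ψ(θ) dθ` is at most `C R^{-1/2} ‖ψ‖_{H¹}`. -/
theorem oscillatory_operator_adjoint_decay_estimate
    (k : ℝ) (hk : 0 < k) (ℓ : ℝ → ℝ → ℂ)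
    (hℓ : ContDiff ℝ 1 (fun p : ℝ × ℝ => ℓ p.1 p.2))
    (hℓper1 : ∀ θ s, ℓ (θ + 2 * π) s = ℓ θ s)
    (hℓper2 : ∀ θ s, ℓ θ (s + 2 * π) = ℓ θ s) :
    ∃ C > 0, ∀ R : ℝ, 1 ≤ R →
      ∀ ψ : ℝ → ℂ, ContDiff ℝ 1 ψ → Function.Periodic ψ (2 * π) →
        Real.sqrt (∫ s in (0:ℝ)..(2 * π),
            ‖∫ θ in (0:ℝ)..(2 * π),
                Complex.exp (-(2 * Complex.I * k * R * Real.cos (θ - s))) * ℓ θ s * ψ θ‖ ^ 2)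
          ≤ C / Real.sqrt R *
              Real.sqrt (∫ θ in (0:ℝ)..(2 * π), (‖ψ θ‖ ^ 2 + ‖deriv ψ θ‖ ^ 2)) := by
  have h2π : 0 < 2 * π := two_pi_pos
  obtain ⟨M, hM, hbound⟩ := exists_bound_and_deriv_bound hℓ (2 * π)
  set A : ℝ := 2 * (2 * π - 0 + π) + 1 with hA
  have hApos : 0 < A := by rw [hA]; linarith [pi_pos]
  refine ⟨√(2 * π) * (A / √(2 * k) * (2 * M * √(2 * (2 * π)))), by positivity,
    fun R hR ψ hψ _ => ?_⟩
  have hR0 : 0 < R := by linarith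
  have hψ' : Continuous (deriv ψ) := hψ.continuous_deriv le_rfl
  have hψc := hψ.continuous
  set N := √(∫ θ in (0:ℝ)..(2 * π), (‖ψ θ‖ ^ 2 + ‖deriv ψ θ‖ ^ 2)) with hN
  set J := ∫ θ in (0:ℝ)..(2 * π), (‖ψ θ‖ + ‖deriv ψ θ‖) with hJ
  have hJN : J ≤ √(2 * (2 * π)) * N := integral_norm_add_norm_le_sqrt hψc hψ' h2π
  set K := A / √(2 * k * R) * (2 * M * (√(2 * (2 * π)) * N)) with hK
  have hinner : ∀ s ∈ Set.Icc 0 (2 * π), ‖∫ θ in (0:ℝ)..(2 * π),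
      Complex.exp (-(2 * Complex.I * k * R * Real.cos (θ - s))) * ℓ θ s * ψ θ‖ ≤ K := by
    intro s hs
    have hℓs : ContDiff ℝ 1 fun θ => ℓ θ s :=
      hℓ.comp (contDiff_id.prodMk contDiff_const)
    have hg : ContDiff ℝ 1 fun θ => ℓ θ s * ψ θ := hℓs.mul hψ
    have hphase : ∀ x ∈ Set.Icc 0 (2 * π), ‖∫ θ in (0:ℝ)..x,
        Complex.exp (-(2 * Complex.I * k * R * Real.cos (θ - s)))‖ ≤ A / √(2 * k * R) := by
      intro x hx
      have heq : ∀ t : ℝ, Complex.exp (-(2 * Complex.I * k * R * Real.cos t))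
          = Complex.exp (-(Complex.I * ((2 * k * R : ℝ) : ℂ) * Real.cos t)) := fun t => by
        push_cast
        ring_nf
      rw [integral_comp_sub_right
        (fun t : ℝ => Complex.exp (-(2 * Complex.I * k * R * Real.cos t))) s]
      simp only [heq]
      refine (norm_integral_exp_mul_cos_le (by positivity) (by linarith [hx.1])).trans ?_
      exact div_le_div_of_nonneg_right (by rw [hA]; linarith [hx.2]) (sqrt_nonneg _)
    have hstep := norm_integral_mul_le_of_norm_primitive_le (by fun_prop) hg h2π.le hphase
    simp only [← mul_assoc] at hstep
    refine hstep.trans (mul_le_mul_of_nonneg_left ?_ (by positivity))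
    have hend : ‖ℓ (2 * π) s * ψ (2 * π)‖ ≤ M * J := by
      rw [norm_mul]
      exact mul_le_mul (hbound _ ⟨h2π.le, le_rfl⟩ s hs).1
        (norm_le_integral_norm_add_norm_deriv hψ (by linarith [pi_gt_three]))
        (norm_nonneg _) hM.le
    have hder : ∫ θ in (0:ℝ)..(2 * π), ‖deriv (fun θ => ℓ θ s * ψ θ) θ‖ ≤ M * J := by
      rw [hJ, ← intervalIntegral.integral_const_mul]
      refine integral_mono_on h2π.le ((hg.continuous_deriv le_rfl).norm.intervalIntegrable _ _)
        (Continuous.intervalIntegrable (by fun_prop) _ _) fun θ hθ => ?_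
      obtain ⟨h1, h2⟩ := hbound θ hθ s hs
      rw [deriv_fun_mul (hℓs.differentiable one_ne_zero θ)
        (hψ.differentiable one_ne_zero θ), mul_add, add_comm]
      refine (norm_add_le _ _).trans ?_
      rw [norm_mul, norm_mul, add_comm]
      gcongr
    nlinarith [mul_le_mul_of_nonneg_left hJN hM.le]
  have hKnn : 0 ≤ K := by positivity
  have houter : ∫ s in (0:ℝ)..(2 * π), ‖∫ θ in (0:ℝ)..(2 * π),
      Complex.exp (-(2 * Complex.I * k * R * Real.cos (θ - s))) * ℓ θ s * ψ θ‖ ^ 2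
      ≤ 2 * π * K ^ 2 := by
    refine (le_norm_self _).trans ((intervalIntegral.norm_integral_le_of_norm_le_const (C := K ^ 2)
      fun s hs => ?_).trans_eq ?_)
    · rw [Set.uIoc_of_le h2π.le] at hs
      rw [norm_pow, norm_norm]
      exact pow_le_pow_left₀ (norm_nonneg _) (hinner s ⟨hs.1.le, hs.2⟩) 2
    · rw [sub_zero, abs_of_pos h2π, mul_comm]
  refine (sqrt_le_sqrt houter).trans_eq ?_
  rw [sqrt_mul h2π.le, sqrt_sq hKnn, hK, sqrt_mul (by positivity : 0 ≤ 2 * k)]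
  field_simp
end
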